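/- arXiv:2110.11637 — 4 statements merged into one kernel-verified Lean document; each statement's English description precedes it below -/
import Mathlib

section
/- Uniqueness of the impacting fixed-point branch for positive shear: let α > 0 and δ ≥ 0. Then the set {K ∈ ℝ : K ≤ 0 and K − α·√(−K) = −δ} is the singleton {−((α/2)·(√(1 + 4δ/α²) − 1))²}. -/
/-- Uniqueness of the impacting fixed-point branch for positive shear: for `δ ≥ 0`, the set
`{K ≤ 0 : K − α√(−K) = −δ}` is the singleton `{−((α/2)(√(1 + 4δ/α²) − 1))²}`. -/
theorem impacting_branch_unique_positive_shear (α δ : ℝ) (hα : 0 < α) (hδ : 0 ≤ δ) :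
    {K : ℝ | K ≤ 0 ∧ K - α * Real.sqrt (-K) = -δ} =
      {-((α / 2) * (Real.sqrt (1 + 4 * δ / α ^ 2) - 1)) ^ 2} := by
  have hs : Real.sqrt (1 + 4 * δ / α ^ 2) ^ 2 = 1 + 4 * δ / α ^ 2 :=
    Real.sq_sqrt (by positivity)
  have hs1 : 1 ≤ Real.sqrt (1 + 4 * δ / α ^ 2) :=
    Real.one_le_sqrt.mpr (le_add_of_nonneg_right (by positivity))
  set r := (α / 2) * (Real.sqrt (1 + 4 * δ / α ^ 2) - 1) with hr
  have hr0 : 0 ≤ r := mul_nonneg (by positivity) (sub_nonneg.mpr hs1)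
  have hroot : r ^ 2 + α * r = δ := by
    calc r ^ 2 + α * r
        = α ^ 2 / 4 * (Real.sqrt (1 + 4 * δ / α ^ 2) ^ 2 - 1) := by rw [hr]; ring
      _ = δ := by rw [hs]; field_simp; ring
  ext K
  simp only [Set.mem_ofPred_eq, Set.mem_singleton_iff]
  constructor
  · rintro ⟨hK, h⟩
    have hx0 := Real.sqrt_nonneg (-K)
    have hx := Real.sq_sqrt (neg_nonneg.mpr hK)
    have hfactor : (Real.sqrt (-K) - r) * (Real.sqrt (-K) + r + α) = 0 := by
      linear_combination hx - h - hroot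
    have hxr : Real.sqrt (-K) = r :=
      sub_eq_zero.mp ((mul_eq_zero.mp hfactor).resolve_right (by positivity))
    rw [← hxr, hx, neg_neg]
  · rintro rfl
    refine ⟨neg_nonpos.mpr (sq_nonneg r), ?_⟩
    rw [neg_neg, Real.sqrt_sq hr0]
    linear_combination -hroot
end

section
/- Period-doubling threshold for positive shear (Lemma B.1, formula for Ω⁺_pd − Ω_c): let α > 0, m > 0 and ε > 0 with ε·m < 4. For δ > 0 set s(δ) = (α/2)·(√(1 + 4δ/α²) − 1). Then for δ > 0 the equation ε·m·(1 + α/(2·s(δ))) = 4 holds if and only if δ = (α²/8)·(ε·m − (ε·m)²/8)/(1 − ε·m/4)². -/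
/-- Period-doubling threshold for positive shear: with
`s δ = (α/2)(√(1 + 4δ/α²) − 1)`, for `δ > 0` the period-doubling condition
`ε·m·(1 + α/(2 s δ)) = 4` holds iff `δ = (α²/8)(εm − (εm)²/8)/(1 − εm/4)²`. -/
theorem period_doubling_threshold_positive_shear (α m ε : ℝ)
    (hα : 0 < α) (hm : 0 < m) (hε : 0 < ε) (hεm : ε * m < 4)
    (s : ℝ → ℝ)
    (hs : ∀ δ : ℝ, s δ = (α / 2) * (Real.sqrt (1 + 4 * δ / α ^ 2) - 1)) :
    ∀ δ : ℝ, 0 < δ →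
      (ε * m * (1 + α / (2 * s δ)) = 4 ↔
        δ = (α ^ 2 / 8) * (ε * m - (ε * m) ^ 2 / 8) / (1 - ε * m / 4) ^ 2) := by
  intro δ hδ
  set x := ε * m
  have hx4 : 0 < 4 - x := by linarith
  have hquot : 0 < 4 * δ / α ^ 2 := by positivity
  rw [hs]
  set r := Real.sqrt (1 + 4 * δ / α ^ 2)
  have hr_sq : r ^ 2 = 1 + 4 * δ / α ^ 2 := Real.sq_sqrt (by linarith)
  have hr_pos : 0 < r := Real.sqrt_pos.mpr (by linarith)
  have hr_one : 0 < r - 1 := by nlinarith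
  have hδr : δ = α ^ 2 / 4 * (r ^ 2 - 1) := by
    rw [hr_sq]
    field_simp
    ring
  have hleft : x * (1 + α / (2 * (α / 2 * (r - 1)))) = 4 ↔ r * (4 - x) = 4 := by
    have hα_div : α / (2 * (α / 2 * (r - 1))) = 1 / (r - 1) := by
      field_simp
    have hadd : x * (1 + 1 / (r - 1)) = x * r / (r - 1) := by
      field_simp
      ring
    rw [hα_div, hadd, div_eq_iff hr_one.ne']
    constructor <;> intro h <;> linarith
  have hright : δ = α ^ 2 / 8 * (x - x ^ 2 / 8) / (1 - x / 4) ^ 2 ↔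
      (r * (4 - x)) ^ 2 = 4 ^ 2 := by
    have hden : 0 < 1 - x / 4 := by linarith
    rw [eq_div_iff (pow_pos hden 2).ne', hδr]
    constructor
    · intro h
      apply mul_left_cancel₀ (pow_pos hα 2).ne'
      linear_combination 64 * h
    · intro h
      linear_combination α ^ 2 / 64 * h
  rw [hleft, hright]
  exact (pow_left_inj₀ (by positivity) (by norm_num) two_ne_zero).symm
end

section
/- Period-doubling threshold for negative shear (Lemma B.1, formula for Ω⁻_pd − Ω_c): let α > 0, m > 0 and ε > 0. For 0 < δ < α²/4 set s₋(δ) = (α/2)·(1 − √(1 − 4δ/α²)). Then for δ ∈ (0, α²/4) the equation ε·m·(α/(2·s₋(δ)) − 1) = 4 holds if and only if δ = (α²/8)·(ε·m + (ε·m)²/8)/(1 + ε·m/4)². -/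
/-- Period-doubling threshold for negative shear: with
`s₋ δ = (α/2)(1 − √(1 − 4δ/α²))`, for `0 < δ < α²/4` the period-doubling condition
`ε·m·(α/(2 s₋ δ) − 1) = 4` holds iff `δ = (α²/8)(εm + (εm)²/8)/(1 + εm/4)²`. -/
theorem period_doubling_threshold_negative_shear (α m ε : ℝ)
    (hα : 0 < α) (hm : 0 < m) (hε : 0 < ε)
    (s : ℝ → ℝ)
    (hs : ∀ δ : ℝ, s δ = (α / 2) * (1 - Real.sqrt (1 - 4 * δ / α ^ 2))) :
    ∀ δ : ℝ, 0 < δ → δ < α ^ 2 / 4 →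
      (ε * m * (α / (2 * s δ) - 1) = 4 ↔
        δ = (α ^ 2 / 8) * (ε * m + (ε * m) ^ 2 / 8) / (1 + ε * m / 4) ^ 2) := by
  intro δ hδ hδ'
  have hα2 : 0 < α ^ 2 := by positivity
  obtain ⟨r, hr⟩ : ∃ r, r = Real.sqrt (1 - 4 * δ / α ^ 2) := ⟨_, rfl⟩
  have hpos : 0 < 1 - 4 * δ / α ^ 2 := by
    rw [sub_pos, div_lt_one hα2]
    linarith
  have hr0 : 0 < r := hr ▸ Real.sqrt_pos.mpr hpos
  have hr2 : r ^ 2 = 1 - 4 * δ / α ^ 2 := by rw [hr, Real.sq_sqrt hpos.le]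
  have hr1 : r < 1 := by
    have : 0 < 4 * δ / α ^ 2 := by positivity
    nlinarith
  have hδr : δ = α ^ 2 / 4 * (1 - r ^ 2) := by
    rw [hr2]
    field_simp
    ring
  have hratio : α / (2 * s δ) = 1 / (1 - r) := by
    rw [hs, ← hr]
    have : 1 - r ≠ 0 := by linarith
    field_simp
  obtain ⟨x, hx⟩ : ∃ x, x = ε * m := ⟨_, rfl⟩
  have hx0 : 0 < x := hx ▸ mul_pos hε hm
  have hx4 : 0 < x + 4 := by linarith
  rw [hratio, ← hx]
  have hleft : x * (1 / (1 - r) - 1) = 4 ↔ r * (x + 4) = 4 := by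
    have h1r : 0 < 1 - r := by linarith
    have : x * (1 / (1 - r) - 1) = x * r / (1 - r) := by
      field_simp
      ring
    rw [this, div_eq_iff h1r.ne']
    constructor <;> intro h <;> linarith
  have hthreshold : α ^ 2 / 8 * (x + x ^ 2 / 8) / (1 + x / 4) ^ 2
      = α ^ 2 / 4 * (1 - (4 / (x + 4)) ^ 2) := by
    have : 1 + x / 4 ≠ 0 := by positivity
    have : 4 + x ≠ 0 := by positivity
    field_simp
    ring
  rw [hleft, hthreshold, hδr, ← eq_div_iff hx4.ne', mul_right_inj' (by positivity),
    sub_right_inj, sq_eq_sq₀ hr0.le (by positivity)]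
end

section
/- The fixed-point branch for positive shear is a single continuous, strictly decreasing branch (Lemma B.1, τ = 1): let α > 0 and j ∈ ℤ, and define 𝐊_j : ℝ → ℝ by 𝐊_j(Ω) = 2πj − Ω for Ω ≤ 2πj and 𝐊_j(Ω) = −((α/2)·(√(1 + 4(Ω − 2πj)/α²) − 1))² for Ω ≥ 2πj. Then 𝐊_j is continuous, strictly decreasing on ℝ, a bijection from ℝ onto ℝ, and satisfies Ω + G(𝐊_j(Ω)) = 2πj for every Ω ∈ ℝ, where G : ℝ → ℝ is defined by G(K) = K if K ≥ 0 and G(K) = K − α·√(−K) if K < 0. -/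
/-- The shear map `K ↦ K` for `K ≥ 0`, `K ↦ K - α√(-K)` for `K < 0`, is strictly increasing. -/
theorem strictMono_ite_sub_mul_sqrt_neg {α : ℝ} (hα : 0 < α) :
    StrictMono fun K : ℝ => if 0 ≤ K then K else K - α * Real.sqrt (-K) := by
  intro a b hab
  have hsqrt : Real.sqrt (-b) ≤ Real.sqrt (-a) := Real.sqrt_le_sqrt (by linarith)
  have hmul := mul_le_mul_of_nonneg_left hsqrt hα.le
  have hnonneg := mul_nonneg hα.le (Real.sqrt_nonneg (-a))
  dsimp only
  split_ifs <;> linarith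

/-- The number `(α/2)(√(1 + 4x/α²) - 1)` is the nonnegative root `s` of `s² + αs = x`. -/
theorem nonneg_root_sq_add_mul {α x : ℝ} (hα : 0 < α) (hx : 0 ≤ x) :
    0 ≤ α / 2 * (Real.sqrt (1 + 4 * x / α ^ 2) - 1) ∧
      (α / 2 * (Real.sqrt (1 + 4 * x / α ^ 2) - 1)) ^ 2 +
        α * (α / 2 * (Real.sqrt (1 + 4 * x / α ^ 2) - 1)) = x := by
  have hdiv : 0 ≤ 4 * x / α ^ 2 := by positivity
  have hone : 1 ≤ Real.sqrt (1 + 4 * x / α ^ 2) := Real.one_le_sqrt.mpr (by linarith)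
  have hsq : Real.sqrt (1 + 4 * x / α ^ 2) ^ 2 = 1 + 4 * x / α ^ 2 :=
    Real.sq_sqrt (by linarith)
  refine ⟨mul_nonneg (by positivity) (by linarith), ?_⟩
  calc
    _ = α ^ 2 / 4 * (Real.sqrt (1 + 4 * x / α ^ 2) ^ 2 - 1) := by ring
    _ = x := by rw [hsq]; field_simp; ring

/-- If `s ≥ 0`, the shear map sends `-s²` to `-(s² + αs)`. -/
theorem ite_sub_mul_sqrt_neg_neg_sq (α : ℝ) {s : ℝ} (hs : 0 ≤ s) :
    (if 0 ≤ -s ^ 2 then -s ^ 2 else -s ^ 2 - α * Real.sqrt (-(-s ^ 2))) =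
      -(s ^ 2 + α * s) := by
  rw [neg_neg, Real.sqrt_sq hs]
  split_ifs with h
  · have : s = 0 := by nlinarith
    simp [this]
  · ring


/-- The fixed-point branch for positive shear is a single continuous, strictly decreasing
branch: `𝐊_j(Ω) = 2πj − Ω` for `Ω ≤ 2πj` and
`𝐊_j(Ω) = −((α/2)(√(1 + 4(Ω − 2πj)/α²) − 1))²` for `Ω ≥ 2πj` is continuous, strictly
decreasing, a bijection of `ℝ`, and satisfies `Ω + G (𝐊_j Ω) = 2πj` for every `Ω`, where
`G K = K` for `K ≥ 0` and `G K = K − α√(−K)` for `K < 0`. -/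
theorem fixed_point_branch_positive_shear (α : ℝ) (hα : 0 < α) (j : ℤ)
    (G : ℝ → ℝ)
    (hG : ∀ K : ℝ, G K = if 0 ≤ K then K else K - α * Real.sqrt (-K))
    (Kj : ℝ → ℝ)
    (hKj : ∀ Ω : ℝ,
      (Ω ≤ 2 * Real.pi * j → Kj Ω = 2 * Real.pi * j - Ω) ∧
      (2 * Real.pi * j ≤ Ω →
        Kj Ω = -((α / 2) *
          (Real.sqrt (1 + 4 * (Ω - 2 * Real.pi * j) / α ^ 2) - 1)) ^ 2)) :
    Continuous Kj ∧ StrictAnti Kj ∧ Function.Bijective Kj ∧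
    ∀ Ω : ℝ, Ω + G (Kj Ω) = 2 * Real.pi * j := by
  have hmono : StrictMono G := by
    rw [funext hG]
    exact strictMono_ite_sub_mul_sqrt_neg hα
  have hfix (Ω : ℝ) : Ω + G (Kj Ω) = 2 * Real.pi * j := by
    rcases le_total Ω (2 * Real.pi * j) with h | h
    · rw [(hKj Ω).1 h, hG, if_pos (sub_nonneg.mpr h)]
      ring
    · obtain ⟨hs, hroot⟩ := nonneg_root_sq_add_mul hα (sub_nonneg.mpr h)
      rw [(hKj Ω).2 h, hG, ite_sub_mul_sqrt_neg_neg_sq α hs, hroot]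
      ring
  have hanti : StrictAnti Kj := fun a b hab =>
    hmono.lt_iff_lt.mp (by linarith [hfix a, hfix b])
  have hsurj : Function.Surjective Kj := fun K =>
    ⟨2 * Real.pi * j - G K, hmono.injective (by linarith [hfix (2 * Real.pi * j - G K)])⟩
  have hcont : Continuous Kj := by
    have hneg : Continuous fun Ω => -Kj Ω :=
      Monotone.continuous_of_surjective hanti.neg.monotone (neg_surjective.comp hsurj)
    exact hneg.neg.congr fun Ω => neg_neg (Kj Ω)
  exact ⟨hcont, hanti, ⟨hanti.injective, hsurj⟩, hfix⟩
end
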